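/- The Fourier transform of the principal value distribution Pv(1/sinh(x/2)) on ℝ is the function ξ ↦ -i√(2π)·tanh(πξ) (with the convention f̂(ξ) = (1/√(2π))∫ e^{-iξx} f(x) dx). -/

import Mathlib

open MeasureTheory Complex Filter

/-- A lower bound for `sinh` with linear vanishing at `0` and exponential growth. -/
lemma mul_exp_le_sinh {x : ℝ} (hx : 0 ≤ x) : x / 4 * Real.exp (x / 4) ≤ Real.sinh (x / 2) := by
  have h1 : x / 4 ≤ Real.sinh (x / 4) := Real.self_le_sinh_iff.2 (by positivity)
  have h2 : Real.exp (x / 4) ≤ 2 * Real.cosh (x / 4) := by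
    rw [Real.cosh_eq]
    linarith [Real.exp_pos (-(x / 4))]
  have h3 : Real.sinh (x / 2) = Real.sinh (x / 4) * (2 * Real.cosh (x / 4)) := by
    rw [show x / 2 = 2 * (x / 4) by ring, Real.sinh_two_mul]
    ring
  rw [h3]
  exact mul_le_mul h1 h2 (Real.exp_pos _).le (by linarith)

lemma inv_sinh_half_le {x : ℝ} (hx : 0 < x) :
    (Real.sinh (x / 2))⁻¹ ≤ 4 / x * Real.exp (-(1 / 4) * x) := by
  have h : 4 / x * Real.exp (-(1 / 4) * x) = (x / 4 * Real.exp (x / 4))⁻¹ := by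
    rw [mul_inv, ← Real.exp_neg, inv_div]
    congr 2
    ring
  rw [h]
  exact inv_anti₀ (by positivity) (mul_exp_le_sinh hx.le)

lemma norm_exp_sub_exp_le (ξ x : ℝ) :
    ‖exp (-I * ξ * x) - exp (I * ξ * x)‖ ≤ 2 * |ξ| * |x| := by
  have h : exp (-I * ξ * x) - exp (I * ξ * x) = -2 * I * (Real.sin (ξ * x) : ℝ) := by
    rw [ofReal_sin, Complex.sin]
    push_cast
    rw [show -(ξ * x : ℂ) * I = -I * ξ * x by ring, show (ξ * x : ℂ) * I = I * ξ * x by ring]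
    linear_combination (exp (-I * ξ * x) - exp (I * ξ * x)) * I_mul_I
  rw [h]
  simp only [norm_mul, norm_neg, norm_I, norm_real, Real.norm_eq_abs, Complex.norm_ofNat, mul_one]
  rw [mul_assoc, ← abs_mul]
  exact mul_le_mul_of_nonneg_left Real.abs_sin_le_abs zero_le_two

lemma continuousOn_exp_div_sinh (a : ℂ) :
    ContinuousOn (fun x : ℝ => exp (a * x) / (Real.sinh (x / 2) : ℂ)) (Set.Ioi 0) := by
  refine ContinuousOn.div (by fun_prop) (by fun_prop) fun x hx => ?_
  exact_mod_cast (Real.sinh_pos_iff.2 (half_pos hx)).ne'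

/-- The odd part (doubled) of the integrand. -/
noncomputable def sinhKernel (ξ x : ℝ) : ℂ :=
  exp (-I * ξ * x) / (Real.sinh (x / 2) : ℂ) - exp (I * ξ * x) / (Real.sinh (x / 2) : ℂ)

lemma norm_sinhKernel_le (ξ : ℝ) {x : ℝ} (hx : 0 < x) :
    ‖sinhKernel ξ x‖ ≤ 8 * |ξ| * Real.exp (-(1 / 4) * x) := by
  have hs : 0 < Real.sinh (x / 2) := Real.sinh_pos_iff.2 (half_pos hx)
  rw [sinhKernel, ← sub_div, norm_div, norm_real, Real.norm_of_nonneg hs.le, div_eq_mul_inv]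
  calc _ ≤ (2 * |ξ| * |x|) * (4 / x * Real.exp (-(1 / 4) * x)) :=
        mul_le_mul (norm_exp_sub_exp_le ξ x) (inv_sinh_half_le hx) (by positivity) (by positivity)
    _ = _ := by
        rw [abs_of_pos hx]
        field_simp
        ring

lemma norm_exp_mul_sinhKernel_le (ξ : ℝ) (n : ℕ) {x : ℝ} (hx : 0 < x) :
    ‖exp (-n * x) * sinhKernel ξ x‖ ≤ 8 * |ξ| * Real.exp (-(n + 1 / 4) * x) := by
  rw [norm_mul, norm_exp]
  have h : (-(n : ℂ) * x).re = -n * x := by simp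
  rw [h]
  calc _ ≤ Real.exp (-n * x) * (8 * |ξ| * Real.exp (-(1 / 4) * x)) := by
        gcongr
        exact norm_sinhKernel_le ξ hx
    _ = _ := by
        rw [show -((n : ℝ) + 1 / 4) * x = -n * x + -(1 / 4) * x by ring, Real.exp_add]
        ring

lemma integrableOn_exp_mul_sinhKernel (ξ : ℝ) (n : ℕ) :
    IntegrableOn (fun x : ℝ => exp (-n * x) * sinhKernel ξ x) (Set.Ioi 0) := by
  refine Integrable.mono' (g := fun x => 8 * |ξ| * Real.exp (-(n + 1 / 4) * x))
    ((integrableOn_exp_mul_Ioi (by linarith [n.cast_nonneg (α := ℝ)]) 0).const_mul _) ?_ ?_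
  · refine ContinuousOn.aestronglyMeasurable (ContinuousOn.mul (by fun_prop) ?_) measurableSet_Ioi
    exact (continuousOn_exp_div_sinh (-I * ξ)).sub (continuousOn_exp_div_sinh (I * ξ))
  · filter_upwards [ae_restrict_mem measurableSet_Ioi] with x hx
    exact norm_exp_mul_sinhKernel_le ξ n hx

lemma integral_sinhKernel_sub (ξ : ℝ) (n : ℕ) :
    (∫ x in Set.Ioi (0 : ℝ), exp (-n * x) * sinhKernel ξ x) -
      ∫ x in Set.Ioi (0 : ℝ), exp (-(n + 1 : ℕ) * x) * sinhKernel ξ x =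
    2 * (1 / (n + 1 / 2 + I * ξ) - 1 / (n + 1 / 2 - I * ξ)) := by
  have hn : (0 : ℝ) ≤ n := n.cast_nonneg
  have h1 : (-(n + 1 / 2 + I * ξ) : ℂ).re < 0 := by
    simp
    linarith
  have h2 : (-(n + 1 / 2 - I * ξ) : ℂ).re < 0 := by
    simp
    linarith
  rw [← integral_sub (integrableOn_exp_mul_sinhKernel ξ n)
    (integrableOn_exp_mul_sinhKernel ξ (n + 1))]
  have h : ∀ x ∈ Set.Ioi (0 : ℝ),
      exp (-n * x) * sinhKernel ξ x - exp (-(n + 1 : ℕ) * x) * sinhKernel ξ x =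
      2 * (exp (-(n + 1 / 2 + I * ξ) * x) - exp (-(n + 1 / 2 - I * ξ) * x)) := by
    intro x hx
    have hs : (Real.sinh (x / 2) : ℂ) ≠ 0 :=
      mod_cast (Real.sinh_pos_iff.2 (half_pos hx)).ne'
    have e1 : exp (-(n + 1 / 2 + I * ξ) * x) =
        exp (-n * x) * exp (-(x / 2)) * exp (-I * ξ * x) := by
      rw [← exp_add, ← exp_add]
      ring_nf
    have e2 : exp (-(n + 1 / 2 - I * ξ) * x) =
        exp (-n * x) * exp (-(x / 2)) * exp (I * ξ * x) := by
      rw [← exp_add, ← exp_add]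
      ring_nf
    have e3 : exp (-(n + 1 : ℕ) * x) = exp (-n * x) * (exp (-(x / 2)) * exp (-(x / 2))) := by
      rw [← exp_add, ← exp_add]
      push_cast
      ring_nf
    have e4 : 1 - exp (-(x / 2)) * exp (-(x / 2)) =
        2 * exp (-(x / 2)) * (Real.sinh (x / 2) : ℂ) := by
      have : exp (x / 2) * exp (-(x / 2)) = 1 := by rw [← exp_add]; simp
      rw [ofReal_sinh, Complex.sinh]
      push_cast
      linear_combination -this
    rw [e1, e2, e3, sinhKernel, ← sub_div]
    set D := exp (-I * ξ * x) - exp (I * ξ * x) with hD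
    calc _ = exp (-n * x) * D * (1 - exp (-(x / 2)) * exp (-(x / 2))) /
          (Real.sinh (x / 2) : ℂ) := by ring
      _ = 2 * (exp (-n * x) * exp (-(x / 2)) * D) := by
          rw [e4]
          field_simp
      _ = _ := by
          rw [hD]
          ring
  rw [setIntegral_congr_fun measurableSet_Ioi h, integral_const_mul,
    integral_sub (integrableOn_exp_mul_complex_Ioi h1 0) (integrableOn_exp_mul_complex_Ioi h2 0),
    integral_exp_mul_complex_Ioi h1, integral_exp_mul_complex_Ioi h2]
  simp only [ofReal_zero, mul_zero, exp_zero, neg_div_neg_eq]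

lemma tendsto_integral_exp_mul_sinhKernel (ξ : ℝ) :
    Tendsto (fun n : ℕ => ∫ x in Set.Ioi (0 : ℝ), exp (-n * x) * sinhKernel ξ x) atTop (nhds 0) := by
  have hb : ∀ n : ℕ, ‖∫ x in Set.Ioi (0 : ℝ), exp (-n * x) * sinhKernel ξ x‖ ≤
      8 * |ξ| * (1 / (n + 1 / 4)) := by
    intro n
    have hneg : -((n : ℝ) + 1 / 4) < 0 := by linarith [n.cast_nonneg (α := ℝ)]
    calc _ ≤ ∫ x in Set.Ioi (0 : ℝ), 8 * |ξ| * Real.exp (-(n + 1 / 4) * x) := by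
          refine norm_integral_le_of_norm_le ((integrableOn_exp_mul_Ioi hneg 0).const_mul _) ?_
          filter_upwards [ae_restrict_mem measurableSet_Ioi] with x hx
          exact norm_exp_mul_sinhKernel_le ξ n hx
      _ = _ := by
          rw [integral_const_mul, integral_exp_mul_Ioi hneg, mul_zero, Real.exp_zero,
            neg_div_neg_eq]
  refine squeeze_zero_norm hb ?_
  have h : Tendsto (fun n : ℕ => 1 / ((n : ℝ) + 1 / 4)) atTop (nhds 0) := by
    simp only [one_div]
    exact (tendsto_atTop_add_const_right _ _ tendsto_natCast_atTop_atTop).inv_tendsto_atTop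
  simpa using h.const_mul (8 * |ξ|)

/-- Partial fraction expansion of the hyperbolic tangent. -/
lemma tendsto_sum_partial_fractions_tanh (ξ : ℝ) :
    Tendsto (fun N : ℕ => ∑ n ∈ Finset.range N,
      (1 / (n + 1 / 2 + I * ξ) - 1 / (n + 1 / 2 - I * ξ) : ℂ)) atTop
      (nhds (-(Real.pi * I * (Real.tanh (Real.pi * ξ) : ℂ)))) := by
  set z : ℂ := 1 / 2 + I * ξ with hz
  have hmem : z ∈ integerComplement := by
    rintro ⟨m, hm⟩
    have h := congrArg Complex.re hm
    have h2 : (2 * m : ℝ) = 1 := by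
      simp [hz] at h
      linarith
    norm_cast at h2
    omega
  have hcot : cot (Real.pi * z) = -(I * (Real.tanh (Real.pi * ξ) : ℂ)) := by
    have e : Real.pi * z = Real.pi * ξ * I + Real.pi / 2 := by rw [hz]; ring
    rw [e, Complex.cot_eq_cos_div_sin, Complex.cos_add_pi_div_two, Complex.sin_add_pi_div_two,
      Complex.sin_mul_I, Complex.cos_mul_I, ofReal_tanh, Complex.tanh_eq_sinh_div_cosh]
    push_cast
    ring
  have hlim := tendsto_logDeriv_euler_cot_sub hmem
  have htail : Tendsto (fun N : ℕ => 1 / (z + N)) atTop (nhds 0) := by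
    simp only [one_div]
    refine tendsto_inv₀_cobounded.comp ?_
    exact (tendsto_const_add_cobounded z).comp tendsto_natCast_atTop_cobounded
  have hsum : ∀ N : ℕ, ∑ n ∈ Finset.range N,
      (1 / (n + 1 / 2 + I * ξ) - 1 / (n + 1 / 2 - I * ξ) : ℂ) =
      (∑ j ∈ Finset.range N, cotTerm z j) + 1 / z - 1 / (z + N) := by
    intro N
    induction N with
    | zero => simp
    | succ N ih =>
      rw [Finset.sum_range_succ, Finset.sum_range_succ, ih]
      have e1 : (N + 1 / 2 + I * ξ : ℂ) = z + N := by rw [hz]; ring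
      have e2 : z - (N + 1) = -(N + 1 / 2 - I * ξ : ℂ) := by rw [hz]; ring
      rw [cotTerm, e1, e2, one_div_neg_eq_neg_one_div]
      push_cast
      ring
  simp_rw [hsum]
  have := (hlim.add_const (1 / z)).sub htail
  rw [hcot] at this
  convert this using 2
  ring

lemma integral_sinhKernel (ξ : ℝ) :
    ∫ x in Set.Ioi (0 : ℝ), sinhKernel ξ x =
      -(2 * Real.pi * I * (Real.tanh (Real.pi * ξ) : ℂ)) := by
  have hN : ∀ N : ℕ, ∫ x in Set.Ioi (0 : ℝ), sinhKernel ξ x =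
      2 * (∑ n ∈ Finset.range N, (1 / (n + 1 / 2 + I * ξ) - 1 / (n + 1 / 2 - I * ξ) : ℂ)) +
      ∫ x in Set.Ioi (0 : ℝ), exp (-N * x) * sinhKernel ξ x := by
    intro N
    rw [Finset.mul_sum, Finset.sum_congr rfl fun n _ => (integral_sinhKernel_sub ξ n).symm,
      Finset.sum_range_sub' (fun n : ℕ => ∫ x in Set.Ioi (0 : ℝ), exp (-n * x) * sinhKernel ξ x)]
    simp
  have hlim := ((tendsto_sum_partial_fractions_tanh ξ).const_mul 2).add
    (tendsto_integral_exp_mul_sinhKernel ξ)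
  simp_rw [← hN] at hlim
  rw [tendsto_nhds_unique tendsto_const_nhds hlim]
  ring

lemma integrableOn_exp_div_sinh {ε : ℝ} (hε : 0 < ε) {a : ℂ} (ha : a.re = 0) :
    IntegrableOn (fun x : ℝ => exp (a * x) / (Real.sinh (x / 2) : ℂ)) (Set.Ioi ε) := by
  refine Integrable.mono' (g := fun x => 4 / ε * Real.exp (-(1 / 4) * x))
    ((integrableOn_exp_mul_Ioi (by norm_num) ε).const_mul _) ?_ ?_
  · exact ((continuousOn_exp_div_sinh a).mono
      (Set.Ioi_subset_Ioi hε.le)).aestronglyMeasurable measurableSet_Ioi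
  · filter_upwards [ae_restrict_mem measurableSet_Ioi] with x hx
    have hx0 : 0 < x := hε.trans hx
    have hs : 0 < Real.sinh (x / 2) := Real.sinh_pos_iff.2 (half_pos hx0)
    have h0 : (a * x).re = 0 := by simp [ha]
    rw [norm_div, norm_exp, h0, Real.exp_zero, norm_real, Real.norm_of_nonneg hs.le, one_div]
    refine (inv_sinh_half_le hx0).trans ?_
    gcongr
    exact le_of_lt hx

lemma setIntegral_exp_div_sinh (ξ : ℝ) {ε : ℝ} (hε : 0 < ε) :
    ∫ x in {x : ℝ | ε ≤ |x|}, exp (-I * ξ * x) / (Real.sinh (x / 2) : ℂ) =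
      ∫ x in Set.Ioi ε, sinhKernel ξ x := by
  set f : ℝ → ℂ := fun x => exp (-I * ξ * x) / (Real.sinh (x / 2) : ℂ) with hf
  have hset : {x : ℝ | ε ≤ |x|} = Set.Iic (-ε) ∪ Set.Ici ε := by
    ext x
    simp only [Set.mem_ofPred_eq, Set.mem_union, Set.mem_Iic, Set.mem_Ici, le_abs']
  have hneg : ∀ x : ℝ, f (-x) = -(exp (I * ξ * x) / (Real.sinh (x / 2) : ℂ)) := by
    intro x
    simp only [hf, neg_div, Real.sinh_neg, ofReal_neg, div_neg, neg_mul, mul_neg, neg_neg]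
  have hpos : IntegrableOn f (Set.Ioi ε) := integrableOn_exp_div_sinh hε (by simp)
  have hpos' : IntegrableOn (fun x : ℝ => exp (I * ξ * x) / (Real.sinh (x / 2) : ℂ))
      (Set.Ioi ε) := integrableOn_exp_div_sinh hε (by simp)
  have hIic : IntegrableOn f (Set.Iic (-ε)) := by
    rw [integrableOn_Iic_iff_integrableOn_Iio]
    have h : IntegrableOn (fun x => f (-x)) (Set.Ioi ε) := by
      simp_rw [hneg]
      exact hpos'.neg
    simpa only [neg_neg] using IntegrableOn.comp_neg_Iio (c := -ε) (f := fun x => f (-x)) (by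
      simpa only [neg_neg] using h)
  rw [hset, setIntegral_union
    (Set.disjoint_left.2 fun x hx hx' => by
      simp only [Set.mem_Iic, Set.mem_Ici] at hx hx'
      linarith) measurableSet_Ici hIic
    ((integrableOn_Ici_iff_integrableOn_Ioi (by simp)).2 hpos), integral_Ici_eq_integral_Ioi,
    ← integral_comp_neg_Ioi]
  simp_rw [hneg, sinhKernel]
  rw [integral_sub hpos hpos', integral_neg]
  ring

/-- The Fourier transform (convention `f̂(ξ) = (1/√(2π)) ∫ e^{-iξx} f(x) dx`) of the
principal value distribution `Pv(1/sinh(x/2))` is `ξ ↦ -i√(2π)·tanh(πξ)`.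
The principal value is realized as the limit, as `ε → 0+`, of the integral over
`{|x| ≥ ε}` (the integrand is absolutely integrable away from the origin). -/
theorem fourier_pv_one_div_sinh :
    ∀ ξ : ℝ,
      Tendsto
        (fun ε : ℝ =>
          ∫ x in {x : ℝ | ε ≤ |x|},
            ((Real.sqrt (2 * Real.pi) : ℂ))⁻¹ *
              Complex.exp (-Complex.I * (ξ : ℂ) * (x : ℂ)) / (Real.sinh (x / 2) : ℂ))
        (nhdsWithin 0 (Set.Ioi 0))
        (nhds (-Complex.I * (Real.sqrt (2 * Real.pi) : ℂ) * (Real.tanh (Real.pi * ξ) : ℂ))) := by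
  intro ξ
  have hlim : Tendsto (fun ε : ℝ => ∫ x in Set.Ioi ε, sinhKernel ξ x)
      (nhdsWithin 0 (Set.Ioi 0)) (nhds (∫ x in Set.Ioi (0 : ℝ), sinhKernel ξ x)) := by
    have hint : IntegrableOn (sinhKernel ξ) (Set.Ioi 0) := by
      simpa using integrableOn_exp_mul_sinhKernel ξ 0
    have h := (aecover_Ioi_of_Ioi (μ := volume) (A := (0 : ℝ)) (a := id)
      (l := nhdsWithin 0 (Set.Ioi 0))
      (tendsto_id.mono_left nhdsWithin_le_nhds)).integral_tendsto_of_countably_generated hint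
    refine h.congr' ?_
    filter_upwards [self_mem_nhdsWithin] with ε hε
    rw [Measure.restrict_restrict measurableSet_Ioi, id,
      Set.inter_eq_left.2 (Set.Ioi_subset_Ioi (le_of_lt hε))]
  have hconst : (-I * (Real.sqrt (2 * Real.pi) : ℂ) * (Real.tanh (Real.pi * ξ) : ℂ)) =
      (Real.sqrt (2 * Real.pi) : ℂ)⁻¹ * ∫ x in Set.Ioi (0 : ℝ), sinhKernel ξ x := by
    have hs : (Real.sqrt (2 * Real.pi) : ℂ) ≠ 0 :=
      mod_cast (Real.sqrt_pos.2 (by positivity)).ne'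
    have hsq : (Real.sqrt (2 * Real.pi) : ℂ) * (Real.sqrt (2 * Real.pi) : ℂ) = 2 * Real.pi := by
      exact_mod_cast Real.mul_self_sqrt (by positivity : 0 ≤ 2 * Real.pi)
    rw [integral_sinhKernel, eq_inv_mul_iff_mul_eq₀ hs]
    linear_combination (-I * (Real.tanh (Real.pi * ξ) : ℂ)) * hsq
  rw [hconst]
  refine (hlim.const_mul _).congr' ?_
  filter_upwards [self_mem_nhdsWithin] with ε hε
  rw [← setIntegral_exp_div_sinh ξ hε, ← integral_const_mul]
  simp_rw [mul_div_assoc]
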